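/- Let γ₁ > γ₀ > −1, I = [γ₀, γ₁], J = [0, 1/(1+γ₀)], and for ε > 0 set U_ε = {z ∈ ℂ : Re z ≤ γ₀ − ε or Re z ≥ γ₁ + ε or |Im z| ≥ ε}. (1) For every φ ∈ 𝒪¹(ℂ̄∖I), the series (Tφ)(z) := Σ_{m≥1} ( −z(φ(1/z − m) − φ(−m)) + φ′(−m) ) converges uniformly on every compact subset K of ℂ∖J, the sum Tφ belongs to 𝒪¹(ℂ̄∖J), and there exist ε > 0 and C_K > 0 (depending only on K and I) such that sup_K |Tφ| ≤ C_K · sup_{U_ε} |φ|. (2) For every ψ ∈ 𝒪³(ℂ̄∖I), the series (T⁽³⁾ψ)(z) := −Σ_{m≥1} z⁻³·ψ(1/z − m) converges uniformly on every compact subset K of ℂ∖J, the sum T⁽³⁾ψ belongs to 𝒪¹(ℂ̄∖J), and there exist ε > 0 and C_K > 0 such that sup_K |T⁽³⁾ψ| ≤ C_K · sup_{U_ε} |ψ|. (3) For every φ ∈ 𝒪¹(ℂ̄∖I), one has (Tφ)″ = T⁽³⁾(φ″) on ℂ∖J. -/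

import Mathlib

open Complex Filter Set Topology
open scoped ENNReal NNReal

noncomputable section

/-- The complement in `ℂ` of the real segment `[a, b]`. -/
def cutPlane (a b : ℝ) : Set ℂ := (Complex.ofReal '' Set.Icc a b)ᶜ

/-- `𝒪¹(ℂ̄ ∖ [a,b])`: holomorphic on `ℂ ∖ [a,b]`, vanishing at infinity. -/
def O1 (a b : ℝ) : Set (ℂ → ℂ) :=
  {φ | DifferentiableOn ℂ φ (cutPlane a b) ∧
       Tendsto φ (Bornology.cobounded ℂ) (nhds 0)}

/-- `𝒪³(ℂ̄ ∖ [a,b])`: holomorphic on `ℂ ∖ [a,b]`, with `z²ψ(z) → 0` at infinity. -/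
def O3 (a b : ℝ) : Set (ℂ → ℂ) :=
  {ψ | DifferentiableOn ℂ ψ (cutPlane a b) ∧
       Tendsto (fun z => z ^ 2 * ψ z) (Bornology.cobounded ℂ) (nhds 0)}

/-- The `m`-th term (for the integer `m+1 ≥ 1`) of the series defining `T`. -/
def Tterm (φ : ℂ → ℂ) (m : ℕ) (z : ℂ) : ℂ :=
  -z * (φ (z⁻¹ - ((m : ℂ) + 1)) - φ (-((m : ℂ) + 1))) + deriv φ (-((m : ℂ) + 1))

/-- The operator `T`. -/
def Tbrj (φ : ℂ → ℂ) : ℂ → ℂ := fun z => ∑' m : ℕ, Tterm φ m z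

/-- The operator `T⁽³⁾`. -/
def T3brj (ψ : ℂ → ℂ) : ℂ → ℂ := fun z => -∑' m : ℕ, (z⁻¹) ^ 3 * ψ (z⁻¹ - ((m : ℂ) + 1))

/-- `g(m) = (0 1; 1 m)`. -/
def gmat (m : ℤ) : Matrix (Fin 2) (Fin 2) ℤ := !![0, 1; 1, m]

/-- The monoid `ℳ`. -/
def Mmon : Set (Matrix (Fin 2) (Fin 2) ℤ) :=
  {g | g = 1 ∨
    ((g 0 0 * g 1 1 - g 0 1 * g 1 0 = 1 ∨ g 0 0 * g 1 1 - g 0 1 * g 1 0 = -1) ∧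
      g 0 1 ≤ g 1 1 ∧ g 0 0 ≤ g 0 1 ∧ 0 ≤ g 0 0 ∧ g 1 0 ≤ g 1 1 ∧ g 0 0 ≤ g 1 0)}

/-- The operator `L_g` on `𝒪¹(ℂ̄ ∖ [0,1])`, for `g = (a b; c d) ∈ ℳ`. -/
def Lop (g : Matrix (Fin 2) (Fin 2) ℤ) (φ : ℂ → ℂ) : ℂ → ℂ := fun z =>
  if g = 1 then φ z
  else
    ((g 0 0 : ℂ) - (g 1 0 : ℂ) * z) *
        (φ (((g 1 1 : ℂ) * z - (g 0 1 : ℂ)) / ((g 0 0 : ℂ) - (g 1 0 : ℂ) * z)) -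
          φ (-(g 1 1 : ℂ) / (g 1 0 : ℂ))) -
      ((g 0 0 * g 1 1 - g 0 1 * g 1 0 : ℤ) : ℂ) * ((g 1 0 : ℂ))⁻¹ *
        deriv φ (-(g 1 1 : ℂ) / (g 1 0 : ℂ))

/-- `Σ_ℳ φ`, the sum of the family `(L_g φ)_{g ∈ ℳ}`. -/
def sumM (φ : ℂ → ℂ) : ℂ → ℂ := fun z => ∑' g : Mmon, Lop g.1 φ z

/-- The domain `D`. -/
def Dset : Set ℂ :=
  {z | ‖z‖ ≤ 1 ∧ 1 ≤ ‖z - Complex.I‖ ∧ 1 ≤ ‖z + Complex.I‖ ∧ 0 < z.re}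

/-- The domain `D₀`. -/
def D0set : Set ℂ := {z | ‖z + 1‖ ≤ 1 ∧ Real.sqrt 3 / 2 - 1 ≤ z.re}

/-- The domain `D₁`. -/
def D1set : Set ℂ :=
  {z | 1 ≤ ‖z‖ ∧ ‖z - (1 / Real.sqrt 3 : ℝ)‖ ≤ 1 / Real.sqrt 3}

/-- The domain `H₀`. -/
def H0set : Set ℂ := {z | ‖z - Complex.I‖ ≤ 1 ∧ 1 ≤ ‖z + 1‖ ∧ z.im ≤ 1 / 2}

/-- The domain `H₀′`. -/
def H0set' : Set ℂ := {z | (starRingEnd ℂ) z ∈ H0set}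

/-- The domain `Δ`. -/
def Δset : Set ℂ := {z | ‖z‖ ≤ 1 ∧ 1 ≤ ‖z + 1‖ ∧ |z.im| ≤ 1 / 2}

/-- The domain `D∞`. -/
def Dinf : Set ℂ :=
  {z | 1 / 2 < |z.im|} ∪ {z | z.re < Real.sqrt 3 / 2 - 1} ∪
    {z | Real.sqrt 3 / 2 < z.re ∧ 1 / Real.sqrt 3 < ‖z - (1 / Real.sqrt 3 : ℝ)‖}

end

/-- The set `U_ε` associated to the interval `[γ₀, γ₁]`. -/
def Ueps (γ₀ γ₁ ε : ℝ) : Set ℂ :=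
  {z : ℂ | z.re ≤ γ₀ - ε ∨ γ₁ + ε ≤ z.re ∨ ε ≤ |z.im|}

open Bornology Metric

theorem isOpen_cutPlane (a b : ℝ) : IsOpen (cutPlane a b) :=
  (isCompact_Icc.image continuous_ofReal).isClosed.isOpen_compl

theorem isClosed_Ueps (a b ε : ℝ) : IsClosed (Ueps a b ε) :=
  (isClosed_le continuous_re continuous_const).union
    ((isClosed_le continuous_const continuous_re).union
      (isClosed_le continuous_const continuous_im.abs))

theorem Ueps_subset_cutPlane (a b : ℝ) {ε : ℝ} (hε : 0 < ε) : Ueps a b ε ⊆ cutPlane a b := by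
  rintro _ hz ⟨x, ⟨hx1, hx2⟩, rfl⟩
  simp only [Ueps, mem_ofPred_eq, ofReal_re, ofReal_im, abs_zero] at hz
  rcases hz with h | h | h <;> linarith

theorem mem_Ueps_of_norm_ge {a b ε : ℝ} {w : ℂ} (hw : |a| + |b| + 2 * ε ≤ ‖w‖) :
    w ∈ Ueps a b ε := by
  by_contra h
  simp only [Ueps, mem_ofPred_eq, not_or, not_le] at h
  obtain ⟨h1, h2, h3⟩ := h
  have h4 := norm_le_abs_re_add_abs_im w
  have h5 : |w.re| < |a| + |b| + ε := by
    rw [abs_lt]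
    constructor <;> linarith [neg_abs_le a, le_abs_self b, abs_nonneg a, abs_nonneg b]
  linarith

theorem nonneg_of_bound_Ueps {a b ε M : ℝ} {φ : ℂ → ℂ} (hM : ∀ w ∈ Ueps a b ε, ‖φ w‖ ≤ M) :
    0 ≤ M := by
  refine (norm_nonneg _).trans (hM (((a - ε : ℝ) : ℂ)) (Or.inl ?_))
  simp

theorem exists_bound_Ueps {a b ε : ℝ} (hε : 0 < ε) {φ : ℂ → ℂ} (hφ : φ ∈ O1 a b) :
    ∃ M, ∀ w ∈ Ueps a b ε, ‖φ w‖ ≤ M := by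
  have h1 : ∀ᶠ w in cobounded ℂ, ‖φ w‖ < 1 := by
    simpa using hφ.2.norm.eventually_lt_const (show ‖(0 : ℂ)‖ < 1 by simp)
  obtain ⟨R, -, hR⟩ := (hasBasis_cobounded_norm (E := ℂ)).eventually_iff.1 h1
  obtain ⟨M, hM⟩ := ((isCompact_closedBall (0 : ℂ) R).inter_right
    (isClosed_Ueps a b ε)).exists_bound_of_continuousOn
    (hφ.1.continuousOn.mono (inter_subset_right.trans (Ueps_subset_cutPlane a b hε)))
  refine ⟨max M 1, fun w hw => ?_⟩
  rcases le_total R ‖w‖ with h | h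
  · exact (hR h).le.trans (le_max_right _ _)
  · exact (hM w ⟨by simpa using h, hw⟩).trans (le_max_left _ _)

theorem O3_subset_O1 (a b : ℝ) : O3 a b ⊆ O1 a b := by
  rintro ψ ⟨h1, h2⟩
  refine ⟨h1, ?_⟩
  have h3 : Tendsto (fun z : ℂ => z⁻¹ ^ 2 * (z ^ 2 * ψ z)) (cobounded ℂ) (𝓝 (0 ^ 2 * 0)) :=
    (tendsto_inv₀_cobounded.pow 2).mul h2
  rw [mul_zero] at h3
  refine h3.congr' ?_
  filter_upwards [eventually_ne_cobounded (0 : ℂ)] with z hz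
  field_simp

/-- Cauchy estimate at the centre, and the second order Taylor remainder, of a bounded
holomorphic function on a disc. -/
theorem taylor_bounds {φ : ℂ → ℂ} {c : ℂ} {ρ M : ℝ} (hρ : 0 < ρ)
    (hd : DifferentiableOn ℂ φ (ball c ρ)) (hM : ∀ w ∈ ball c ρ, ‖φ w‖ ≤ M) :
    ‖deriv φ c‖ ≤ 2 * M / ρ ∧
      ∀ v : ℂ, ‖v‖ < ρ → ‖φ (c + v) - φ c - deriv φ c * v‖ ≤ 4 * M * ‖v‖ ^ 2 / ρ ^ 2 := by
  have hc : c ∈ ball c ρ := mem_ball_self hρ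
  have maps : ∀ {f : ℂ → ℂ} {B : ℝ}, (∀ w ∈ ball c ρ, ‖f w‖ ≤ B) →
      MapsTo f (ball c ρ) (closedBall (f c) (2 * B)) := fun h w hw => by
    rw [mem_closedBall, dist_eq_norm]
    linarith [norm_sub_le_of_le (h w hw) (h c hc)]
  have h1 : ∀ w ∈ ball c ρ, ‖dslope φ c w‖ ≤ 2 * M / ρ := fun w hw =>
    norm_dslope_le_div_of_mapsTo_ball hd (maps hM) hw
  have hd1 : DifferentiableOn ℂ (dslope φ c) (ball c ρ) :=
    (differentiableOn_dslope (isOpen_ball.mem_nhds hc)).2 hd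
  refine ⟨by simpa using h1 c hc, fun v hv => ?_⟩
  have hcv : c + v ∈ ball c ρ := by simpa using hv
  have h2 := norm_dslope_le_div_of_mapsTo_ball hd1 (maps h1) hcv
  have e1 := sub_smul_dslope φ c (c + v)
  have e2 := sub_smul_dslope (dslope φ c) c (c + v)
  rw [dslope_same] at e2
  simp only [add_sub_cancel_left, smul_eq_mul] at e1 e2
  have e3 : φ (c + v) - φ c - deriv φ c * v = v ^ 2 * dslope (dslope φ c) c (c + v) := by
    rw [← e1]; linear_combination (-v) * e2
  rw [e3, norm_mul, norm_pow]
  calc ‖v‖ ^ 2 * ‖dslope (dslope φ c) c (c + v)‖ ≤ ‖v‖ ^ 2 * (2 * (2 * M / ρ) / ρ) := by gcongr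
    _ = 4 * M * ‖v‖ ^ 2 / ρ ^ 2 := by field_simp; ring

/-- Maximum modulus principle on the exterior of a disc. -/
theorem norm_le_of_exterior {f : ℂ → ℂ} {R B : ℝ} (hB : 0 ≤ B)
    (hd : ∀ z, R ≤ ‖z‖ → DifferentiableAt ℂ f z)
    (hlim : Tendsto f (cobounded ℂ) (𝓝 0)) (hb : ∀ z, ‖z‖ = R → ‖f z‖ ≤ B)
    {w : ℂ} (hw : R ≤ ‖w‖) : ‖f w‖ ≤ B := by
  refine le_of_forall_pos_le_add fun η hη => ?_
  have h1 : ∀ᶠ z in cobounded ℂ, ‖f z‖ < η := by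
    simpa using hlim.norm.eventually_lt_const (show ‖(0 : ℂ)‖ < η by simpa)
  obtain ⟨R', -, hR'⟩ := (hasBasis_cobounded_norm (E := ℂ)).eventually_iff.1 h1
  rcases le_or_gt R' ‖w‖ with h | h
  · linarith [hR' h]
  have hU : IsOpen {z : ℂ | R < ‖z‖ ∧ ‖z‖ < R'} :=
    (isOpen_lt continuous_const continuous_norm).inter (isOpen_lt continuous_norm continuous_const)
  have hcl : closure {z : ℂ | R < ‖z‖ ∧ ‖z‖ < R'} ⊆ {z : ℂ | R ≤ ‖z‖ ∧ ‖z‖ ≤ R'} :=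
    closure_minimal (fun z hz => ⟨hz.1.le, hz.2.le⟩)
      ((isClosed_le continuous_const continuous_norm).inter
        (isClosed_le continuous_norm continuous_const))
  rcases hw.eq_or_lt with hw' | hw'
  · linarith [hb w hw'.symm]
  refine norm_le_of_forall_mem_frontier_norm_le (U := {z : ℂ | R < ‖z‖ ∧ ‖z‖ < R'}) ?_ ?_ ?_
    (subset_closure ⟨hw', h⟩)
  · exact isBounded_ball.subset (fun z hz => by simpa using hz.2 : _ ⊆ ball (0 : ℂ) R')
  · exact DifferentiableOn.diffContOnCl
      fun z hz => (hd z (hcl hz).1).differentiableWithinAt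
  · intro z hz
    rw [hU.frontier_eq] at hz
    obtain ⟨h3, h4⟩ := hcl hz.1
    rcases h3.eq_or_lt with h5 | h5
    · linarith [hb z h5.symm]
    · have : R' ≤ ‖z‖ := not_lt.1 fun h6 => hz.2 ⟨h5, h6⟩
      linarith [hR' this]

theorem summable_inv_add_sq {a : ℝ} (ha : 0 < a) : Summable fun m : ℕ => 1 / ((m : ℝ) + a) ^ 2 := by
  refine ((Real.summable_one_div_nat_add_rpow a 2).2 one_lt_two).congr fun m => ?_
  rw [abs_of_pos (by positivity)]
  norm_num

theorem tsum_inv_add_sq_pos {a : ℝ} (ha : 0 < a) : 0 < ∑' m : ℕ, 1 / ((m : ℝ) + a) ^ 2 :=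
  (summable_inv_add_sq ha).tsum_pos (fun m => by positivity) 0 (by positivity)

theorem ball_subset_Ueps {a b r : ℝ} (hr : r = (1 + a) / 2) {ε : ℝ} (hε : ε ≤ r) (m : ℕ) :
    ball (-((m : ℂ) + 1)) (m + r) ⊆ Ueps a b ε := by
  intro w hw
  left
  rw [mem_ball, dist_eq_norm] at hw
  have := (abs_re_le_norm _).trans_lt hw
  simp only [sub_re, neg_re, add_re, natCast_re, one_re] at this
  have := (abs_lt.1 this).2
  linarith

theorem Tterm_eq (φ : ℂ → ℂ) (m : ℕ) {z : ℂ} (hz : z ≠ 0) :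
    Tterm φ m z = -z * (φ (-((m : ℂ) + 1) + z⁻¹) - φ (-((m : ℂ) + 1)) -
      deriv φ (-((m : ℂ) + 1)) * z⁻¹) := by
  rw [Tterm, neg_add_eq_sub]
  field_simp
  ring

/-- Bound for `Tterm` when `z⁻¹` is small compared to the distance from `-(m+1)` to the segment. -/
theorem norm_Tterm_le_of_lt {a b r ε M : ℝ} (hr : r = (1 + a) / 2) (hε : 0 < ε)
    (hεr : ε ≤ r) {φ : ℂ → ℂ} (hφ : φ ∈ O1 a b) (hM : ∀ w ∈ Ueps a b ε, ‖φ w‖ ≤ M)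
    (m : ℕ) {z : ℂ} (hz : z ≠ 0) (hv : ‖z⁻¹‖ < m + r) :
    ‖Tterm φ m z‖ ≤ 4 * M * ‖z⁻¹‖ * (1 / ((m : ℝ) + r) ^ 2) := by
  have hsub := ball_subset_Ueps (b := b) hr hεr m
  have hpos : 0 < (m : ℝ) + r := (norm_nonneg _).trans_lt hv
  have h := (taylor_bounds hpos (hφ.1.mono (hsub.trans (Ueps_subset_cutPlane a b hε)))
    fun w hw => hM w (hsub hw)).2 z⁻¹ hv
  rw [Tterm_eq φ m hz, norm_mul, norm_neg]
  have hz' : 0 < ‖z‖ := norm_pos_iff.2 hz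
  refine (mul_le_mul_of_nonneg_left h hz'.le).trans_eq ?_
  rw [norm_inv]
  field_simp

theorem norm_Tterm_le {a b r ε M A B : ℝ} (hr : r = (1 + a) / 2) (hε : 0 < ε)
    (hεr : ε ≤ r) {φ : ℂ → ℂ} (hφ : φ ∈ O1 a b) (hM : ∀ w ∈ Ueps a b ε, ‖φ w‖ ≤ M)
    (m : ℕ) {z : ℂ} (hz : z ≠ 0) (hA : ‖z‖ ≤ A) (hB : ‖z⁻¹‖ ≤ B)
    (hU : z⁻¹ - ((m : ℂ) + 1) ∈ Ueps a b ε) :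
    ‖Tterm φ m z‖ ≤ (4 * B + (2 * A + 2 / r) * B ^ 2) * M * (1 / ((m : ℝ) + r) ^ 2) := by
  have hM0 := nonneg_of_bound_Ueps hM
  have hr0 : 0 < r := by linarith
  have hB0 : 0 ≤ B := (norm_nonneg _).trans hB
  have hA0 : 0 ≤ A := (norm_nonneg _).trans hA
  have hpos : 0 < (m : ℝ) + r := by positivity
  rcases lt_or_ge ‖z⁻¹‖ (m + r) with h | h
  · refine (norm_Tterm_le_of_lt hr hε hεr hφ hM m hz h).trans ?_
    gcongr ?_ * _
    have h1 : 0 ≤ (2 * A + 2 / r) * B ^ 2 * M := by positivity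
    have h2 : 4 * M * ‖z⁻¹‖ ≤ 4 * M * B := by gcongr
    linarith
  · have hsub := ball_subset_Ueps (b := b) hr hεr m
    have hd := (taylor_bounds hpos (hφ.1.mono (hsub.trans (Ueps_subset_cutPlane a b hε)))
      fun w hw => hM w (hsub hw)).1
    have hd' : ‖deriv φ (-((m : ℂ) + 1))‖ ≤ 2 * M / r := by
      refine hd.trans ?_
      gcongr
      linarith [(Nat.cast_nonneg m : (0 : ℝ) ≤ m)]
    have h1 : ‖Tterm φ m z‖ ≤ A * (M + M) + 2 * M / r := by
      refine norm_add_le_of_le ?_ hd'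
      rw [norm_mul, norm_neg]
      gcongr
      exact norm_sub_le_of_le (hM _ hU) (hM _ (hsub (mem_ball_self hpos)))
    have h2 : 1 ≤ B ^ 2 * (1 / ((m : ℝ) + r) ^ 2) := by
      rw [mul_one_div, one_le_div (by positivity)]
      gcongr
      exact h.trans hB
    calc ‖Tterm φ m z‖ ≤ (2 * A + 2 / r) * M * 1 := h1.trans_eq (by ring)
      _ ≤ (2 * A + 2 / r) * M * (B ^ 2 * (1 / ((m : ℝ) + r) ^ 2)) := by gcongr
      _ ≤ (2 * A + 2 / r) * M * (B ^ 2 * (1 / ((m : ℝ) + r) ^ 2)) +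
          4 * B * M * (1 / ((m : ℝ) + r) ^ 2) := le_add_of_nonneg_right (by positivity)
      _ = _ := by ring

theorem norm_O3_le {a b ε M B R : ℝ} (hε : 0 < ε) (hR : R = |a| + |b| + 2 * ε)
    {ψ : ℂ → ℂ} (hψ : ψ ∈ O3 a b) (hM : ∀ w ∈ Ueps a b ε, ‖ψ w‖ ≤ M)
    (m : ℕ) {v : ℂ} (hB : ‖v‖ ≤ B) (hU : v - ((m : ℂ) + 1) ∈ Ueps a b ε) :
    ‖ψ (v - ((m : ℂ) + 1))‖ ≤ (2 * R ^ 2 + 2 * B ^ 2) * M * (1 / ((m : ℝ) + 1) ^ 2) := by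
  have hM0 := nonneg_of_bound_Ueps hM
  have hR0 : 0 < R := by rw [hR]; positivity
  set w := v - ((m : ℂ) + 1) with hw
  have h1 : ‖w‖ ^ 2 * ‖ψ w‖ ≤ R ^ 2 * M := by
    rcases le_total ‖w‖ R with h | h
    · gcongr
      exact hM w hU
    · have key := norm_le_of_exterior (f := fun z => z ^ 2 * ψ z) (B := R ^ 2 * M)
        (by positivity) (fun z hz => ?_) hψ.2 (fun z hz => ?_) h
      · simpa using key
      · have hz' : z ∈ cutPlane a b :=
          Ueps_subset_cutPlane a b hε (mem_Ueps_of_norm_ge (hR ▸ hz))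
        exact (differentiableAt_id.pow 2).mul
          (hψ.1.differentiableAt ((isOpen_cutPlane a b).mem_nhds hz'))
      · rw [norm_mul, norm_pow, hz]
        gcongr
        exact hM z (mem_Ueps_of_norm_ge (hR ▸ hz.ge))
  have h2 : (m : ℝ) + 1 ≤ ‖w‖ + B := by
    have h3 : ‖((m : ℂ) + 1)‖ = m + 1 := by exact_mod_cast Complex.norm_natCast (m + 1)
    rw [← h3, show ((m : ℂ) + 1) = v - w by rw [hw]; ring, add_comm ‖w‖]
    exact norm_sub_le_of_le hB le_rfl
  have h4 : ((m : ℝ) + 1) ^ 2 ≤ 2 * ‖w‖ ^ 2 + 2 * B ^ 2 := by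
    have : ((m : ℝ) + 1) ^ 2 ≤ (‖w‖ + B) ^ 2 := by gcongr
    nlinarith [sq_nonneg (‖w‖ - B)]
  rw [mul_one_div, le_div_iff₀ (by positivity), mul_comm]
  calc ((m : ℝ) + 1) ^ 2 * ‖ψ w‖ ≤ (2 * ‖w‖ ^ 2 + 2 * B ^ 2) * ‖ψ w‖ := by gcongr
    _ = 2 * (‖w‖ ^ 2 * ‖ψ w‖) + 2 * B ^ 2 * ‖ψ w‖ := by ring
    _ ≤ 2 * (R ^ 2 * M) + 2 * B ^ 2 * M := by gcongr; exact hM w hU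
    _ = _ := by ring

theorem norm_T3term_le {a b ε M B R : ℝ} (hε : 0 < ε) (hR : R = |a| + |b| + 2 * ε)
    {ψ : ℂ → ℂ} (hψ : ψ ∈ O3 a b) (hM : ∀ w ∈ Ueps a b ε, ‖ψ w‖ ≤ M)
    (m : ℕ) {v : ℂ} (hB : ‖v‖ ≤ B) (hU : v - ((m : ℂ) + 1) ∈ Ueps a b ε) :
    ‖v ^ 3 * ψ (v - ((m : ℂ) + 1))‖ ≤
      ‖v‖ ^ 3 * (2 * R ^ 2 + 2 * B ^ 2) * M * (1 / ((m : ℝ) + 1) ^ 2) := by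
  rw [norm_mul, norm_pow]
  refine (mul_le_mul_of_nonneg_left (norm_O3_le hε hR hψ hM m hB hU) (by positivity)).trans_eq ?_
  ring

theorem ne_zero_of_mem_cutPlane {c : ℝ} (hc : 0 ≤ c) {z : ℂ} (hz : z ∈ cutPlane 0 c) : z ≠ 0 :=
  fun h => hz ⟨0, ⟨le_rfl, hc⟩, by simp [h]⟩

theorem inv_sub_mem_cutPlane {a b : ℝ} (h0 : -1 < a) {z : ℂ}
    (hz : z ∈ cutPlane 0 (1 / (1 + a))) (m : ℕ) : z⁻¹ - ((m : ℂ) + 1) ∈ cutPlane a b := by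
  rintro ⟨x, ⟨hx, -⟩, h⟩
  have hpos : 0 < 1 + a := by linarith
  have hm : (0 : ℝ) ≤ m := Nat.cast_nonneg m
  have hge : 1 + a ≤ x + m + 1 := by linarith
  refine hz ⟨(x + m + 1)⁻¹, ⟨inv_nonneg.2 (hpos.le.trans hge), ?_⟩, ?_⟩
  · rw [one_div]; gcongr
  · have : z⁻¹ = ((x + m + 1 : ℝ) : ℂ) := by push_cast; linear_combination -h
    rw [ofReal_inv, ← this, inv_inv]

/-- A compact subset of `ℂ ∖ [0, 1/(1+a)]` is bounded, its inverse is bounded, and the translates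
of its inverse stay uniformly away from `[a, b]`. -/
theorem exists_uniform_bounds {a b : ℝ} (h0 : -1 < a) {K : Set ℂ} (hK : IsCompact K)
    (hKJ : K ⊆ cutPlane 0 (1 / (1 + a))) :
    ∃ ε > 0, ε ≤ (1 + a) / 2 ∧ ∃ A > 0, ∃ B > 0, ∀ z ∈ K,
      z ≠ 0 ∧ ‖z‖ ≤ A ∧ ‖z⁻¹‖ ≤ B ∧ ∀ m : ℕ, z⁻¹ - ((m : ℂ) + 1) ∈ Ueps a b ε := by
  have hpos : 0 < 1 + a := by linarith
  have hne : ∀ z ∈ K, z ≠ 0 := fun z hz => ne_zero_of_mem_cutPlane (by positivity) (hKJ hz)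
  have hinv : ContinuousOn (fun z : ℂ => z⁻¹) K := continuousOn_inv₀.mono hne
  obtain ⟨A, hA⟩ := hK.exists_bound_of_continuousOn continuousOn_id
  obtain ⟨B, hB⟩ := hK.exists_bound_of_continuousOn hinv
  have hf : ContinuousOn (fun z : ℂ => max (1 + a - (z⁻¹).re) |(z⁻¹).im|) K :=
    (continuousOn_const.sub (continuous_re.comp_continuousOn hinv)).sup
      (continuous_im.comp_continuousOn hinv).abs
  obtain ⟨δ, hδ, hδK⟩ := hK.exists_forall_le' hf (a := 0) fun z hz => by
    by_contra! h
    obtain ⟨h1, h2⟩ := max_le_iff.1 h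
    have h3 : (z⁻¹).im = 0 := abs_eq_zero.1 (le_antisymm h2 (abs_nonneg _))
    refine inv_sub_mem_cutPlane (b := (z⁻¹).re - 1) h0 (hKJ hz) 0
      ⟨(z⁻¹).re - 1, ⟨by linarith, le_rfl⟩, ?_⟩
    apply Complex.ext <;> simp [h3]
  refine ⟨min δ ((1 + a) / 2), by positivity, min_le_right _ _, max A 1, by positivity, max B 1,
    by positivity, fun z hz => ⟨hne z hz, (hA z hz).trans (le_max_left _ _),
      (hB z hz).trans (le_max_left _ _), fun m => ?_⟩⟩
  have hε := min_le_left δ ((1 + a) / 2)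
  have hm : (0 : ℝ) ≤ m := Nat.cast_nonneg m
  rcases le_max_iff.1 (hδK z hz) with h | h
  · left
    simp only [sub_re, add_re, natCast_re, one_re]
    linarith
  · right; right
    simp only [sub_im, add_im, natCast_im, one_im]
    simpa using hε.trans h

theorem Tbrj_estimates {a b : ℝ} (h0 : -1 < a) {K : Set ℂ} (hK : IsCompact K)
    (hKJ : K ⊆ cutPlane 0 (1 / (1 + a))) :
    ∃ ε > 0, ∃ C > 0, ∀ φ ∈ O1 a b,
      TendstoUniformlyOn (fun N z => ∑ m ∈ Finset.range N, Tterm φ m z) (Tbrj φ) atTop K ∧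
        ∀ M : ℝ, (∀ w ∈ Ueps a b ε, ‖φ w‖ ≤ M) → ∀ z ∈ K, ‖Tbrj φ z‖ ≤ C * M := by
  obtain ⟨ε, hε, hεr, A, hA, B, hB, hz⟩ := exists_uniform_bounds (b := b) h0 hK hKJ
  have hr : 0 < (1 + a) / 2 := by linarith
  have hS := summable_inv_add_sq hr
  have hS0 := tsum_inv_add_sq_pos hr
  have key : ∀ φ ∈ O1 a b, ∀ M : ℝ, (∀ w ∈ Ueps a b ε, ‖φ w‖ ≤ M) → ∀ (m : ℕ), ∀ z ∈ K,
      ‖Tterm φ m z‖ ≤ (4 * B + (2 * A + 2 / ((1 + a) / 2)) * B ^ 2) * M *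
        (1 / ((m : ℝ) + (1 + a) / 2) ^ 2) := fun φ hφ M hM m z hzK =>
    norm_Tterm_le rfl hε hεr hφ hM m (hz z hzK).1 (hz z hzK).2.1 (hz z hzK).2.2.1
      ((hz z hzK).2.2.2 m)
  refine ⟨ε, hε, (4 * B + (2 * A + 2 / ((1 + a) / 2)) * B ^ 2) *
    ∑' m : ℕ, 1 / ((m : ℝ) + (1 + a) / 2) ^ 2, by positivity, fun φ hφ => ⟨?_, ?_⟩⟩
  · obtain ⟨M, hM⟩ := exists_bound_Ueps hε hφ
    exact tendstoUniformlyOn_tsum_nat (hS.mul_left _) (key φ hφ M hM)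
  · intro M hM z hzK
    refine (tsum_of_norm_bounded (hS.hasSum.mul_left _)
      fun m => key φ hφ M hM m z hzK).trans_eq (by ring)

theorem T3brj_estimates {a b : ℝ} (h0 : -1 < a) {K : Set ℂ} (hK : IsCompact K)
    (hKJ : K ⊆ cutPlane 0 (1 / (1 + a))) :
    ∃ ε > 0, ∃ C > 0, ∀ ψ ∈ O3 a b,
      TendstoUniformlyOn
          (fun N z => -∑ m ∈ Finset.range N, (z⁻¹) ^ 3 * ψ (z⁻¹ - ((m : ℂ) + 1)))
          (T3brj ψ) atTop K ∧
        ∀ M : ℝ, (∀ w ∈ Ueps a b ε, ‖ψ w‖ ≤ M) → ∀ z ∈ K, ‖T3brj ψ z‖ ≤ C * M := by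
  obtain ⟨ε, hε, -, A, -, B, hB, hz⟩ := exists_uniform_bounds (b := b) h0 hK hKJ
  have hS := summable_inv_add_sq one_pos
  have hS0 := tsum_inv_add_sq_pos one_pos
  have key : ∀ ψ ∈ O3 a b, ∀ M : ℝ, (∀ w ∈ Ueps a b ε, ‖ψ w‖ ≤ M) → ∀ (m : ℕ), ∀ z ∈ K,
      ‖(z⁻¹) ^ 3 * ψ (z⁻¹ - ((m : ℂ) + 1))‖ ≤
        B ^ 3 * (2 * (|a| + |b| + 2 * ε) ^ 2 + 2 * B ^ 2) * M * (1 / ((m : ℝ) + 1) ^ 2) := by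
    intro ψ hψ M hM m z hzK
    have hM0 := nonneg_of_bound_Ueps hM
    obtain ⟨-, -, hB', hU⟩ := hz z hzK
    refine (norm_T3term_le hε rfl hψ hM m hB' (hU m)).trans ?_
    gcongr
  refine ⟨ε, hε, B ^ 3 * (2 * (|a| + |b| + 2 * ε) ^ 2 + 2 * B ^ 2) *
    ∑' m : ℕ, 1 / ((m : ℝ) + 1) ^ 2, by positivity, fun ψ hψ => ⟨?_, ?_⟩⟩
  · obtain ⟨M, hM⟩ := exists_bound_Ueps hε (O3_subset_O1 a b hψ)
    exact (tendstoUniformlyOn_tsum_nat (hS.mul_left _) (key ψ hψ M hM)).neg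
  · intro M hM z hzK
    rw [T3brj, norm_neg]
    exact (tsum_of_norm_bounded (hS.hasSum.mul_left _)
      fun m => key ψ hψ M hM m z hzK).trans_eq (by ring)

theorem tendstoLocallyUniformlyOn_Tbrj {a b : ℝ} (h0 : -1 < a) {φ : ℂ → ℂ} (hφ : φ ∈ O1 a b) :
    TendstoLocallyUniformlyOn (fun N z => ∑ m ∈ Finset.range N, Tterm φ m z) (Tbrj φ) atTop
      (cutPlane 0 (1 / (1 + a))) := by
  refine (tendstoLocallyUniformlyOn_iff_forall_isCompact (isOpen_cutPlane _ _)).2 fun K hKJ hK => ?_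
  obtain ⟨ε, -, C, -, h⟩ := Tbrj_estimates (b := b) h0 hK hKJ
  exact (h φ hφ).1

theorem tendstoLocallyUniformlyOn_T3brj {a b : ℝ} (h0 : -1 < a) {ψ : ℂ → ℂ} (hψ : ψ ∈ O3 a b) :
    TendstoLocallyUniformlyOn
      (fun N z => -∑ m ∈ Finset.range N, (z⁻¹) ^ 3 * ψ (z⁻¹ - ((m : ℂ) + 1))) (T3brj ψ) atTop
      (cutPlane 0 (1 / (1 + a))) := by
  refine (tendstoLocallyUniformlyOn_iff_forall_isCompact (isOpen_cutPlane _ _)).2 fun K hKJ hK => ?_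
  obtain ⟨ε, -, C, -, h⟩ := T3brj_estimates (b := b) h0 hK hKJ
  exact (h ψ hψ).1

theorem hasDerivAt_comp_inv_sub {a b : ℝ} (h0 : -1 < a) {f : ℂ → ℂ}
    (hf : DifferentiableOn ℂ f (cutPlane a b)) {z : ℂ} (hz : z ∈ cutPlane 0 (1 / (1 + a)))
    (m : ℕ) :
    HasDerivAt (fun z => f (z⁻¹ - ((m : ℂ) + 1)))
      (deriv f (z⁻¹ - ((m : ℂ) + 1)) * (-(z ^ 2)⁻¹)) z := by
  have hpos : 0 < 1 + a := by linarith
  have hz0 : z ≠ 0 := ne_zero_of_mem_cutPlane (by positivity) hz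
  have h1 := (hf.differentiableAt ((isOpen_cutPlane a b).mem_nhds
    (inv_sub_mem_cutPlane h0 hz m))).hasDerivAt
  exact h1.comp z ((hasDerivAt_inv hz0).sub_const _)

theorem hasDerivAt_Tterm {a b : ℝ} (h0 : -1 < a) {φ : ℂ → ℂ}
    (hφ : DifferentiableOn ℂ φ (cutPlane a b)) {z : ℂ} (hz : z ∈ cutPlane 0 (1 / (1 + a)))
    (m : ℕ) :
    HasDerivAt (Tterm φ m)
      (-(φ (z⁻¹ - ((m : ℂ) + 1)) - φ (-((m : ℂ) + 1))) +
        z⁻¹ * deriv φ (z⁻¹ - ((m : ℂ) + 1))) z := by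
  have hpos : 0 < 1 + a := by linarith
  have hz0 : z ≠ 0 := ne_zero_of_mem_cutPlane (by positivity) hz
  have h := (((hasDerivAt_neg z).mul ((hasDerivAt_comp_inv_sub h0 hφ hz m).sub_const
    (φ (-((m : ℂ) + 1))))).add_const (deriv φ (-((m : ℂ) + 1))))
  refine h.congr_deriv ?_
  field_simp

theorem hasDerivAt_deriv_Tterm {a b : ℝ} (h0 : -1 < a) {φ : ℂ → ℂ}
    (hφ : DifferentiableOn ℂ φ (cutPlane a b)) {z : ℂ} (hz : z ∈ cutPlane 0 (1 / (1 + a)))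
    (m : ℕ) :
    HasDerivAt (fun z => -(φ (z⁻¹ - ((m : ℂ) + 1)) - φ (-((m : ℂ) + 1))) +
        z⁻¹ * deriv φ (z⁻¹ - ((m : ℂ) + 1)))
      (-((z⁻¹) ^ 3 * deriv (deriv φ) (z⁻¹ - ((m : ℂ) + 1)))) z := by
  have hpos : 0 < 1 + a := by linarith
  have hz0 : z ≠ 0 := ne_zero_of_mem_cutPlane (by positivity) hz
  have h := ((hasDerivAt_comp_inv_sub h0 hφ hz m).sub_const (φ (-((m : ℂ) + 1)))).neg.add
    ((hasDerivAt_inv hz0).mul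
      (hasDerivAt_comp_inv_sub h0 (hφ.deriv (isOpen_cutPlane a b)) hz m))
  refine h.congr_deriv ?_
  field_simp
  ring

theorem mem_Ueps_of_inv_small {a b : ℝ} {z : ℂ} (hz : ‖z⁻¹‖ < (1 + a) / 2) (m : ℕ) :
    z⁻¹ - ((m : ℂ) + 1) ∈ Ueps a b ((1 + a) / 2) := by
  left
  have h1 := (re_le_norm z⁻¹).trans hz.le
  have hm : (0 : ℝ) ≤ m := Nat.cast_nonneg m
  simp only [sub_re, add_re, natCast_re, one_re]
  linarith

theorem eventually_norm_inv_lt {r : ℝ} (hr : 0 < r) :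
    ∀ᶠ z : ℂ in cobounded ℂ, z ≠ 0 ∧ ‖z⁻¹‖ < r := by
  refine (eventually_ne_cobounded 0).and ?_
  exact (tendsto_inv₀_cobounded (α := ℂ)).norm.eventually_lt_const (by simpa using hr)

theorem Tbrj_mem_O1 {a b : ℝ} (h0 : -1 < a) {φ : ℂ → ℂ} (hφ : φ ∈ O1 a b) :
    Tbrj φ ∈ O1 0 (1 / (1 + a)) := by
  constructor
  · refine (tendstoLocallyUniformlyOn_Tbrj h0 hφ).differentiableOn (.of_forall fun N => ?_)
      (isOpen_cutPlane _ _)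
    exact DifferentiableOn.fun_sum fun m _ z hz =>
      (hasDerivAt_Tterm h0 hφ.1 hz m).differentiableAt.differentiableWithinAt
  · have hr : 0 < (1 + a) / 2 := by linarith
    obtain ⟨M, hM⟩ := exists_bound_Ueps hr hφ
    have hS := summable_inv_add_sq hr
    have hlim : Tendsto (fun z : ℂ => 4 * M * ‖z⁻¹‖ * ∑' m : ℕ, 1 / ((m : ℝ) + (1 + a) / 2) ^ 2)
        (cobounded ℂ) (𝓝 0) := by
      simpa only [norm_zero, mul_zero, zero_mul] using
        ((tendsto_inv₀_cobounded (α := ℂ)).norm.const_mul (4 * M)).mul_const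
        (∑' m : ℕ, 1 / ((m : ℝ) + (1 + a) / 2) ^ 2)
    refine squeeze_zero_norm' ?_ hlim
    filter_upwards [eventually_norm_inv_lt hr] with z ⟨hz, hv⟩
    exact tsum_of_norm_bounded (hS.hasSum.mul_left _) fun m =>
      norm_Tterm_le_of_lt rfl hr le_rfl hφ hM m hz
        (by linarith [(Nat.cast_nonneg m : (0 : ℝ) ≤ m)])

theorem T3brj_mem_O1 {a b : ℝ} (h0 : -1 < a) {ψ : ℂ → ℂ} (hψ : ψ ∈ O3 a b) :
    T3brj ψ ∈ O1 0 (1 / (1 + a)) := by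
  have hpos : 0 < 1 + a := by linarith
  constructor
  · refine (tendstoLocallyUniformlyOn_T3brj h0 hψ).differentiableOn (.of_forall fun N => ?_)
      (isOpen_cutPlane _ _)
    refine (DifferentiableOn.fun_sum fun m _ z hz => ?_).neg
    have hz0 : z ≠ 0 := ne_zero_of_mem_cutPlane (by positivity) hz
    exact (((differentiableAt_inv hz0).pow 3).mul
      (hasDerivAt_comp_inv_sub h0 hψ.1 hz m).differentiableAt).differentiableWithinAt
  · have hr : 0 < (1 + a) / 2 := by linarith
    obtain ⟨M, hM⟩ := exists_bound_Ueps hr (O3_subset_O1 a b hψ)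
    have hS := summable_inv_add_sq one_pos
    set D := 2 * (|a| + |b| + 2 * ((1 + a) / 2)) ^ 2 + 2 * ((1 + a) / 2) ^ 2
    have hlim : Tendsto (fun z : ℂ => ‖z⁻¹‖ ^ 3 * D * M * ∑' m : ℕ, 1 / ((m : ℝ) + 1) ^ 2)
        (cobounded ℂ) (𝓝 0) := by
      simpa only [norm_zero, zero_mul, zero_pow three_ne_zero] using ((((tendsto_inv₀_cobounded (α := ℂ)).norm.pow 3).mul_const D).mul_const
        M).mul_const (∑' m : ℕ, 1 / ((m : ℝ) + 1) ^ 2)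
    refine squeeze_zero_norm' ?_ hlim
    filter_upwards [eventually_norm_inv_lt hr] with z ⟨hz, hv⟩
    rw [T3brj, norm_neg]
    exact tsum_of_norm_bounded (hS.hasSum.mul_left _) fun m =>
      norm_T3term_le hr rfl hψ hM m hv.le (mem_Ueps_of_inv_small hv m)

theorem deriv_deriv_mem_O3 {a b : ℝ} {φ : ℂ → ℂ} (hφ : φ ∈ O1 a b) :
    deriv (deriv φ) ∈ O3 a b := by
  refine ⟨(hφ.1.deriv (isOpen_cutPlane a b)).deriv (isOpen_cutPlane a b), ?_⟩
  rw [(hasBasis_cobounded_norm (E := ℂ)).tendsto_iff nhds_basis_ball]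
  intro η hη
  have h1 : ∀ᶠ w in cobounded ℂ, ‖φ w‖ < η / 16 := by
    simpa using hφ.2.norm.eventually_lt_const (show ‖(0 : ℂ)‖ < η / 16 by simpa)
  obtain ⟨R, -, hR⟩ := (hasBasis_cobounded_norm (E := ℂ)).eventually_iff.1 h1
  set R' := max (max R 1) (|a| + |b| + 2 * 1)
  refine ⟨2 * R', trivial, fun z hz => ?_⟩
  have hz' : 2 * R' ≤ ‖z‖ := hz
  have hR1 : 1 ≤ R' := (le_max_right R 1).trans (le_max_left _ _)
  have hfar : ∀ w ∈ closedBall z (‖z‖ / 2), R' ≤ ‖w‖ := fun w hw => by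
    rw [mem_closedBall, dist_comm, dist_eq_norm] at hw
    linarith [norm_sub_norm_le z w]
  have hpos : 0 < ‖z‖ / 2 := by linarith
  have hd : DiffContOnCl ℂ φ (ball z (‖z‖ / 2)) := by
    refine DifferentiableOn.diffContOnCl (hφ.1.mono fun w hw => ?_)
    exact Ueps_subset_cutPlane a b one_pos (mem_Ueps_of_norm_ge
      ((le_max_right _ _).trans (hfar w (closure_ball_subset_closedBall hw))))
  have h2 := norm_iteratedDeriv_le_of_forall_mem_sphere_norm_le 2 hpos hd (C := η / 16)
    fun w hw => (hR (((le_max_left R 1).trans (le_max_left _ _)).trans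
      (hfar w (sphere_subset_closedBall hw)))).le
  rw [iteratedDeriv_succ, iteratedDeriv_one] at h2
  rw [mem_ball_zero_iff, norm_mul, norm_pow]
  calc ‖z‖ ^ 2 * ‖deriv (deriv φ) z‖
      ≤ ‖z‖ ^ 2 * ((Nat.factorial 2 : ℕ) * (η / 16) / (‖z‖ / 2) ^ 2) := by gcongr
    _ = η / 2 := by
      have : ‖z‖ ≠ 0 := by linarith
      simp only [Nat.factorial]
      field_simp
      norm_num
    _ < η := by linarith

theorem deriv_deriv_Tbrj {a b : ℝ} (h0 : -1 < a) {φ : ℂ → ℂ} (hφ : φ ∈ O1 a b) {z : ℂ}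
    (hz : z ∈ cutPlane 0 (1 / (1 + a))) :
    deriv (deriv (Tbrj φ)) z = T3brj (deriv (deriv φ)) z := by
  have hO := isOpen_cutPlane 0 (1 / (1 + a))
  have hd1 : ∀ N : ℕ, ∀ w ∈ cutPlane 0 (1 / (1 + a)),
      HasDerivAt (fun w => ∑ m ∈ Finset.range N, Tterm φ m w)
        (∑ m ∈ Finset.range N, (-(φ (w⁻¹ - ((m : ℂ) + 1)) - φ (-((m : ℂ) + 1))) +
          w⁻¹ * deriv φ (w⁻¹ - ((m : ℂ) + 1)))) w := fun N w hw =>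
    HasDerivAt.fun_sum fun m _ => hasDerivAt_Tterm h0 hφ.1 hw m
  have hd2 : ∀ N : ℕ, ∀ w ∈ cutPlane 0 (1 / (1 + a)),
      HasDerivAt (fun w => ∑ m ∈ Finset.range N,
        (-(φ (w⁻¹ - ((m : ℂ) + 1)) - φ (-((m : ℂ) + 1))) +
          w⁻¹ * deriv φ (w⁻¹ - ((m : ℂ) + 1))))
        (∑ m ∈ Finset.range N, -((w⁻¹) ^ 3 * deriv (deriv φ) (w⁻¹ - ((m : ℂ) + 1)))) w :=
    fun N w hw => HasDerivAt.fun_sum fun m _ => hasDerivAt_deriv_Tterm h0 hφ.1 hw m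
  have hdiff : ∀ N : ℕ, DifferentiableOn ℂ (fun w => ∑ m ∈ Finset.range N, Tterm φ m w)
      (cutPlane 0 (1 / (1 + a))) := fun N w hw =>
    (hd1 N w hw).differentiableAt.differentiableWithinAt
  have hlim := (((tendstoLocallyUniformlyOn_Tbrj h0 hφ).deriv (.of_forall hdiff) hO).deriv
    (.of_forall fun N => (hdiff N).deriv hO) hO).tendsto_at hz
  have hlim3 := (tendstoLocallyUniformlyOn_T3brj h0 (deriv_deriv_mem_O3 hφ)).tendsto_at hz
  refine tendsto_nhds_unique (hlim.congr fun N => ?_) hlim3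
  have heq : deriv (fun w => ∑ m ∈ Finset.range N, Tterm φ m w) =ᶠ[𝓝 z] fun w =>
      ∑ m ∈ Finset.range N, (-(φ (w⁻¹ - ((m : ℂ) + 1)) - φ (-((m : ℂ) + 1))) +
          w⁻¹ * deriv φ (w⁻¹ - ((m : ℂ) + 1))) := by
    filter_upwards [hO.mem_nhds hz] with w hw using (hd1 N w hw).deriv
  simp only [Function.comp_apply]
  rw [heq.deriv_eq, (hd2 N z hz).deriv, Finset.sum_neg_distrib]

/-- convergence and basic estimates for the operators `T` and `T⁽³⁾`. -/
theorem T_and_T3_basic (γ₀ γ₁ : ℝ) (h0 : -1 < γ₀) (h1 : γ₀ < γ₁) :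
    (∀ K : Set ℂ, IsCompact K → K ⊆ cutPlane 0 (1 / (1 + γ₀)) →
      ∃ ε > 0, ∃ C > 0, ∀ φ ∈ O1 γ₀ γ₁,
        TendstoUniformlyOn (fun N z => ∑ m ∈ Finset.range N, Tterm φ m z)
            (Tbrj φ) atTop K ∧
          ∀ M : ℝ, (∀ w ∈ Ueps γ₀ γ₁ ε, ‖φ w‖ ≤ M) →
            ∀ z ∈ K, ‖Tbrj φ z‖ ≤ C * M) ∧
      (∀ φ ∈ O1 γ₀ γ₁, Tbrj φ ∈ O1 0 (1 / (1 + γ₀))) ∧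
      (∀ K : Set ℂ, IsCompact K → K ⊆ cutPlane 0 (1 / (1 + γ₀)) →
        ∃ ε > 0, ∃ C > 0, ∀ ψ ∈ O3 γ₀ γ₁,
          TendstoUniformlyOn
              (fun N z => -∑ m ∈ Finset.range N, (z⁻¹) ^ 3 * ψ (z⁻¹ - ((m : ℂ) + 1)))
              (T3brj ψ) atTop K ∧
            ∀ M : ℝ, (∀ w ∈ Ueps γ₀ γ₁ ε, ‖ψ w‖ ≤ M) →
              ∀ z ∈ K, ‖T3brj ψ z‖ ≤ C * M) ∧
      (∀ ψ ∈ O3 γ₀ γ₁, T3brj ψ ∈ O1 0 (1 / (1 + γ₀))) ∧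
      ∀ φ ∈ O1 γ₀ γ₁, ∀ z ∈ cutPlane 0 (1 / (1 + γ₀)),
        deriv (deriv (Tbrj φ)) z = T3brj (deriv (deriv φ)) z := by
  exact ⟨fun _ hK hKJ => Tbrj_estimates h0 hK hKJ, fun _ hφ => Tbrj_mem_O1 h0 hφ,
    fun _ hK hKJ => T3brj_estimates h0 hK hKJ, fun _ hψ => T3brj_mem_O1 h0 hψ,
    fun _ hφ _ hz => deriv_deriv_Tbrj h0 hφ hz⟩
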